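/- arXiv:0802.3517 — 8 statements merged into one kernel-verified Lean document; each statement's English description precedes it below -/
import Mathlib

section
/- Let (S,T) be a Moufang-Mal'tsev pair. Then [S_x, T_y] = [T_x, S_y] in L for all x, y in M. -/
/-- Moufang-Mal'tsev pair: context shared by all statements.
`F` is a field of characteristic ≠ 2, 3; `M` an `F`-vector space with an
anticommutative bilinear multiplication `mul`; `L` a Lie algebra over `F`;
`S, T : M →ₗ[F] L` satisfy the Moufang-Mal'tsev relations. -/
theorem stmt_0
    (F : Type*) [Field F] (hchar2 : (2 : F) ≠ 0) (hchar3 : (3 : F) ≠ 0)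
    (M : Type*) [AddCommGroup M] [Module F M]
    (L : Type*) [LieRing L] [LieAlgebra F L]
    (mul : M →ₗ[F] M →ₗ[F] M)
    (anticomm : ∀ x y : M, mul x y = - mul y x)
    (S T : M →ₗ[F] L)
    (hST1 : ∀ x y : M, ⁅S x, S y⁆ = S (mul x y) - (2 : F) • ⁅S x, T y⁆)
    (hST2 : ∀ x y : M, ⁅T x, T y⁆ = T (mul y x) - (2 : F) • ⁅T x, S y⁆)
    :
    ∀ x y : M, ⁅S x, T y⁆ = ⁅T x, S y⁆ := by
  intro x y
  have hyx := hST1 y x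
  rw [← lie_skew (S y) (S x), hST1 x y, anticomm y x, map_neg] at hyx
  have h : (2 : F) • ⁅S x, T y⁆ = (2 : F) • -⁅S y, T x⁆ := by
    rw [smul_neg]
    linear_combination (norm := module) hyx
  rw [smul_right_injective L hchar2 h, lie_skew]
end

section
/- Let (S,T) be a Moufang-Mal'tsev pair and set P := -(S+T), so that S + T + P = 0. Then (T, P) is a Moufang-Mal'tsev pair; that is, [T_x, T_y] = T_{[x,y]} - 2[T_x, P_y] and [P_x, P_y] = P_{[y,x]} - 2[P_x, T_y] for all x, y in M. -/
/-- Moufang-Mal'tsev pair: context shared by all statements.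
`F` is a field of characteristic ≠ 2, 3; `M` an `F`-vector space with an
anticommutative bilinear multiplication `mul`; `L` a Lie algebra over `F`;
`S, T : M →ₗ[F] L` satisfy the Moufang-Mal'tsev relations. -/
theorem stmt_3
    (F : Type*) [Field F] (hchar2 : (2 : F) ≠ 0) (hchar3 : (3 : F) ≠ 0)
    (M : Type*) [AddCommGroup M] [Module F M]
    (L : Type*) [LieRing L] [LieAlgebra F L]
    (mul : M →ₗ[F] M →ₗ[F] M)
    (anticomm : ∀ x y : M, mul x y = - mul y x)
    (S T : M →ₗ[F] L)
    (hST1 : ∀ x y : M, ⁅S x, S y⁆ = S (mul x y) - (2 : F) • ⁅S x, T y⁆)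
    (hST2 : ∀ x y : M, ⁅T x, T y⁆ = T (mul y x) - (2 : F) • ⁅T x, S y⁆)
    (P : M →ₗ[F] L) (hP : P = -(S + T))
    :
    ∀ x y : M,
      ⁅T x, T y⁆ = T (mul x y) - (2 : F) • ⁅T x, P y⁆ ∧
      ⁅P x, P y⁆ = P (mul y x) - (2 : F) • ⁅P x, T y⁆ := by
  intro x y
  have swapped := hST1 y x
  rw [anticomm y x, ← lie_skew (S y) (S x), ← lie_skew (S y) (T x), hST1 x y, map_neg] at swapped
  have mixed : ⁅S x, T y⁆ = ⁅T x, S y⁆ := by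
    apply smul_right_injective L hchar2
    linear_combination (norm := module) swapped
  have hS := hST1 x y
  have hT := hST2 x y
  rw [anticomm y x, map_neg] at hT
  subst hP
  rw [anticomm y x]
  simp only [LinearMap.neg_apply, LinearMap.add_apply, lie_neg, neg_lie, lie_add, add_lie,
    map_neg, neg_neg]
  constructor
  · linear_combination (norm := module) (-1 : F) • hT
  · linear_combination (norm := module) hS - hT - (3 : F) • mixed
end

section
/- Let (S,T) be a Moufang-Mal'tsev pair and set P := -(S+T), so that S + T + P = 0. Then (P, S) is a Moufang-Mal'tsev pair; that is, [P_x, P_y] = P_{[x,y]} - 2[P_x, S_y] and [S_x, S_y] = S_{[y,x]} - 2[S_x, P_y] for all x, y in M. -/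
/-- Moufang-Mal'tsev pair: context shared by all statements.
`F` is a field of characteristic ≠ 2, 3; `M` an `F`-vector space with an
anticommutative bilinear multiplication `mul`; `L` a Lie algebra over `F`;
`S, T : M →ₗ[F] L` satisfy the Moufang-Mal'tsev relations. -/
theorem stmt_4
    (F : Type*) [Field F] (hchar2 : (2 : F) ≠ 0) (hchar3 : (3 : F) ≠ 0)
    (M : Type*) [AddCommGroup M] [Module F M]
    (L : Type*) [LieRing L] [LieAlgebra F L]
    (mul : M →ₗ[F] M →ₗ[F] M)
    (anticomm : ∀ x y : M, mul x y = - mul y x)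
    (S T : M →ₗ[F] L)
    (hST1 : ∀ x y : M, ⁅S x, S y⁆ = S (mul x y) - (2 : F) • ⁅S x, T y⁆)
    (hST2 : ∀ x y : M, ⁅T x, T y⁆ = T (mul y x) - (2 : F) • ⁅T x, S y⁆)
    (P : M →ₗ[F] L) (hP : P = -(S + T))
    :
    ∀ x y : M,
      ⁅P x, P y⁆ = P (mul x y) - (2 : F) • ⁅P x, S y⁆ ∧
      ⁅S x, S y⁆ = S (mul y x) - (2 : F) • ⁅S x, P y⁆ := by
  have lie_comm_ST : ∀ x y : M, ⁅S x, T y⁆ = ⁅T x, S y⁆ := by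
    intro x y
    have hyx := hST1 y x
    rw [← lie_skew (S y) (S x), ← lie_skew (S y) (T x), anticomm y x, map_neg] at hyx
    refine (smul_right_injective L hchar2) ?_
    change (2 : F) • ⁅S x, T y⁆ = (2 : F) • ⁅T x, S y⁆
    linear_combination (norm := module) hST1 x y + hyx
  intro x y
  have h1 := hST1 x y
  have h2 := hST2 x y
  rw [anticomm y x, map_neg, ← lie_comm_ST] at h2
  subst hP
  simp only [LinearMap.neg_apply, LinearMap.add_apply, neg_lie, lie_neg, add_lie, lie_add,
    ← lie_comm_ST x y, anticomm y x, map_neg]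
  constructor
  · linear_combination (norm := module) h2 - h1
  · linear_combination (norm := module) -h1
end

section
/- Let (S,T) be a Moufang-Mal'tsev pair and set P := -(S+T), so that S + T + P = 0. Then (-P, -T) is a Moufang-Mal'tsev pair; that is, [(-P)_x, (-P)_y] = (-P)_{[x,y]} - 2[(-P)_x, (-T)_y] and [(-T)_x, (-T)_y] = (-T)_{[y,x]} - 2[(-T)_x, (-P)_y] for all x, y in M. -/
/-- Moufang-Mal'tsev pair: context shared by all statements.
`F` is a field of characteristic ≠ 2, 3; `M` an `F`-vector space with an
anticommutative bilinear multiplication `mul`; `L` a Lie algebra over `F`;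
`S, T : M →ₗ[F] L` satisfy the Moufang-Mal'tsev relations. -/
theorem stmt_5
    (F : Type*) [Field F] (hchar2 : (2 : F) ≠ 0) (hchar3 : (3 : F) ≠ 0)
    (M : Type*) [AddCommGroup M] [Module F M]
    (L : Type*) [LieRing L] [LieAlgebra F L]
    (mul : M →ₗ[F] M →ₗ[F] M)
    (anticomm : ∀ x y : M, mul x y = - mul y x)
    (S T : M →ₗ[F] L)
    (hST1 : ∀ x y : M, ⁅S x, S y⁆ = S (mul x y) - (2 : F) • ⁅S x, T y⁆)
    (hST2 : ∀ x y : M, ⁅T x, T y⁆ = T (mul y x) - (2 : F) • ⁅T x, S y⁆)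
    (P : M →ₗ[F] L) (hP : P = -(S + T))
    :
    ∀ x y : M,
      ⁅(-P) x, (-P) y⁆ = (-P) (mul x y) - (2 : F) • ⁅(-P) x, (-T) y⁆ ∧
      ⁅(-T) x, (-T) y⁆ = (-T) (mul y x) - (2 : F) • ⁅(-T) x, (-P) y⁆ := by
  intro x y
  have cross : ⁅S x, T y⁆ = ⁅T x, S y⁆ := by
    have h := hST1 y x
    rw [← lie_skew (S y) (S x), ← lie_skew (S y) (T x), hST1 x y, anticomm y x, map_neg] at h
    have h' : (2 : F) • ⁅S x, T y⁆ = (2 : F) • ⁅T x, S y⁆ := by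
      linear_combination (norm := module) h
    exact smul_right_injective L hchar2 h'
  have hS := hST1 x y
  have hT := hST2 x y
  rw [anticomm y x, map_neg] at hT
  subst hP
  simp only [neg_neg, LinearMap.neg_apply, LinearMap.add_apply, lie_add, add_lie, lie_neg,
    neg_lie, anticomm y x, map_neg, ← cross] at hT ⊢
  constructor
  · linear_combination (norm := module) hS - hT
  · linear_combination (norm := module) -hT
end

section
/- Let (S,T) be a Moufang-Mal'tsev pair and set P := -(S+T), so that S + T + P = 0. Then (-S, -P) is a Moufang-Mal'tsev pair; that is, [(-S)_x, (-S)_y] = (-S)_{[x,y]} - 2[(-S)_x, (-P)_y] and [(-P)_x, (-P)_y] = (-P)_{[y,x]} - 2[(-P)_x, (-S)_y] for all x, y in M. -/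
/-- Moufang-Mal'tsev pair: context shared by all statements.
`F` is a field of characteristic ≠ 2, 3; `M` an `F`-vector space with an
anticommutative bilinear multiplication `mul`; `L` a Lie algebra over `F`;
`S, T : M →ₗ[F] L` satisfy the Moufang-Mal'tsev relations. -/
theorem stmt_6
    (F : Type*) [Field F] (hchar2 : (2 : F) ≠ 0) (hchar3 : (3 : F) ≠ 0)
    (M : Type*) [AddCommGroup M] [Module F M]
    (L : Type*) [LieRing L] [LieAlgebra F L]
    (mul : M →ₗ[F] M →ₗ[F] M)
    (anticomm : ∀ x y : M, mul x y = - mul y x)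
    (S T : M →ₗ[F] L)
    (hST1 : ∀ x y : M, ⁅S x, S y⁆ = S (mul x y) - (2 : F) • ⁅S x, T y⁆)
    (hST2 : ∀ x y : M, ⁅T x, T y⁆ = T (mul y x) - (2 : F) • ⁅T x, S y⁆)
    (P : M →ₗ[F] L) (hP : P = -(S + T))
    :
    ∀ x y : M,
      ⁅(-S) x, (-S) y⁆ = (-S) (mul x y) - (2 : F) • ⁅(-S) x, (-P) y⁆ ∧
      ⁅(-P) x, (-P) y⁆ = (-P) (mul y x) - (2 : F) • ⁅(-P) x, (-S) y⁆ := by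
  intro x y
  have hcross : ⁅S x, T y⁆ = ⁅T x, S y⁆ := by
    have hyx := hST1 y x
    rw [anticomm y x, map_neg, ← lie_skew (S y) (S x), ← lie_skew (S y) (T x), hST1 x y] at hyx
    have htwo : (2 : F) • ⁅S x, T y⁆ = (2 : F) • ⁅T x, S y⁆ := by
      linear_combination (norm := module) hyx
    exact smul_right_injective L hchar2 htwo
  have hSS := hST1 x y
  have hTT := hST2 x y
  rw [anticomm y x, map_neg] at hTT
  subst hP
  simp only [neg_neg, LinearMap.neg_apply, LinearMap.add_apply, anticomm y x, map_neg,
    neg_lie, lie_neg, add_lie, lie_add, hSS, hTT, hcross]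
  constructor <;> module
end

section
/- Let (S,T) be a Moufang-Mal'tsev pair, set P := -(S+T), and define the triality conjugates S⁺ := T - P = S + 2T, T⁺ := P - S, and P⁺ := S - T. Then the Moufang-Mal'tsev conditions can be rewritten as: [S_x, S⁺_y] = [S⁺_x, S_y] = S_{[x,y]}, [T_x, T⁺_y] = [T⁺_x, T_y] = T_{[x,y]}, and [P_x, P⁺_y] = [P⁺_x, P_y] = P_{[x,y]} for all x, y in M. -/
/-- Moufang-Mal'tsev pair: context shared by all statements.
`F` is a field of characteristic ≠ 2, 3; `M` an `F`-vector space with an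
anticommutative bilinear multiplication `mul`; `L` a Lie algebra over `F`;
`S, T : M →ₗ[F] L` satisfy the Moufang-Mal'tsev relations. -/
theorem stmt_7
    (F : Type*) [Field F] (hchar2 : (2 : F) ≠ 0) (hchar3 : (3 : F) ≠ 0)
    (M : Type*) [AddCommGroup M] [Module F M]
    (L : Type*) [LieRing L] [LieAlgebra F L]
    (mul : M →ₗ[F] M →ₗ[F] M)
    (anticomm : ∀ x y : M, mul x y = - mul y x)
    (S T : M →ₗ[F] L)
    (hST1 : ∀ x y : M, ⁅S x, S y⁆ = S (mul x y) - (2 : F) • ⁅S x, T y⁆)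
    (hST2 : ∀ x y : M, ⁅T x, T y⁆ = T (mul y x) - (2 : F) • ⁅T x, S y⁆)
    (P : M →ₗ[F] L) (hP : P = -(S + T))
    (Sp : M →ₗ[F] L) (hSp : Sp = T - P)
    (Tp : M →ₗ[F] L) (hTp : Tp = P - S)
    (Pp : M →ₗ[F] L) (hPp : Pp = S - T)
    :
    ∀ x y : M,
      (⁅S x, Sp y⁆ = S (mul x y) ∧ ⁅Sp x, S y⁆ = S (mul x y)) ∧
      (⁅T x, Tp y⁆ = T (mul x y) ∧ ⁅Tp x, T y⁆ = T (mul x y)) ∧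
      (⁅P x, Pp y⁆ = P (mul x y) ∧ ⁅Pp x, P y⁆ = P (mul x y)) := by
  subst hSp hTp hPp hP
  have mixed : ∀ x y : M, ⁅S x, T y⁆ = ⁅T x, S y⁆ := by
    intro x y
    have h := hST1 y x
    rw [← lie_skew, hST1 x y, anticomm y x, map_neg, ← lie_skew (S y) (T x)] at h
    refine smul_right_injective L hchar2 ?_
    linear_combination (norm := module) h
  have swap : ∀ A B C : M →ₗ[F] L, (∀ x y, ⁅A x, B y⁆ = C (mul x y)) →
      ∀ x y, ⁅B x, A y⁆ = C (mul x y) := by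
    intro A B C h x y
    rw [← lie_skew, h, anticomm y x, map_neg, neg_neg]
  have hS : ∀ x y : M, ⁅S x, (T - -(S + T)) y⁆ = S (mul x y) := by
    intro x y
    simp only [LinearMap.sub_apply, LinearMap.neg_apply, LinearMap.add_apply, lie_sub, lie_neg,
      lie_add, hST1]
    module
  have hT : ∀ x y : M, ⁅T x, (-(S + T) - S) y⁆ = T (mul x y) := by
    intro x y
    simp only [LinearMap.sub_apply, LinearMap.neg_apply, LinearMap.add_apply, lie_sub, lie_neg,
      lie_add, hST2, anticomm y x, map_neg]
    module
  have hPP : ∀ x y : M, ⁅(-(S + T)) x, (S - T) y⁆ = (-(S + T)) (mul x y) := by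
    intro x y
    simp only [LinearMap.sub_apply, LinearMap.neg_apply, LinearMap.add_apply, lie_sub, neg_lie,
      add_lie, hST1, hST2, anticomm y x, map_neg, mixed]
    module
  exact fun x y => ⟨⟨hS x y, swap _ _ _ hS x y⟩, ⟨hT x y, swap _ _ _ hT x y⟩,
    ⟨hPP x y, swap _ _ _ hPP x y⟩⟩
end

section
/- Let (S,T) be a Moufang-Mal'tsev pair, set P := -(S+T), define the triality conjugates S⁺ := T - P, T⁺ := P - S, P⁺ := S - T, and define the Yamagutian Y : M × M → L by Y(x;y) := (1/6)([S_x,S_y] + [T_x,T_y] + [P_x,P_y]). Then 6Y(x;y) = 3[S_x,S_y] - S⁺_{[x,y]} = 3[T_x,T_y] - T⁺_{[x,y]} = 3[P_x,P_y] - P⁺_{[x,y]} for all x, y in M. -/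
/-- Moufang-Mal'tsev pair: context shared by all statements.
`F` is a field of characteristic ≠ 2, 3; `M` an `F`-vector space with an
anticommutative bilinear multiplication `mul`; `L` a Lie algebra over `F`;
`S, T : M →ₗ[F] L` satisfy the Moufang-Mal'tsev relations. -/
theorem stmt_8
    (F : Type*) [Field F] (hchar2 : (2 : F) ≠ 0) (hchar3 : (3 : F) ≠ 0)
    (M : Type*) [AddCommGroup M] [Module F M]
    (L : Type*) [LieRing L] [LieAlgebra F L]
    (mul : M →ₗ[F] M →ₗ[F] M)
    (anticomm : ∀ x y : M, mul x y = - mul y x)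
    (S T : M →ₗ[F] L)
    (hST1 : ∀ x y : M, ⁅S x, S y⁆ = S (mul x y) - (2 : F) • ⁅S x, T y⁆)
    (hST2 : ∀ x y : M, ⁅T x, T y⁆ = T (mul y x) - (2 : F) • ⁅T x, S y⁆)
    (P : M →ₗ[F] L) (hP : P = -(S + T))
    (Sp : M →ₗ[F] L) (hSp : Sp = T - P)
    (Tp : M →ₗ[F] L) (hTp : Tp = P - S)
    (Pp : M →ₗ[F] L) (hPp : Pp = S - T)
    (Y : M → M → L)
    (hY : ∀ x y : M, Y x y = (6 : F)⁻¹ • (⁅S x, S y⁆ + ⁅T x, T y⁆ + ⁅P x, P y⁆))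
    :
    ∀ x y : M,
      (6 : F) • Y x y = (3 : F) • ⁅S x, S y⁆ - Sp (mul x y) ∧
      (6 : F) • Y x y = (3 : F) • ⁅T x, T y⁆ - Tp (mul x y) ∧
      (6 : F) • Y x y = (3 : F) • ⁅P x, P y⁆ - Pp (mul x y) := by
  intro x y
  have h6 : (6 : F) ≠ 0 := by
    have h : (6 : F) = 2 * 3 := by norm_num
    rw [h]
    exact mul_ne_zero hchar2 hchar3
  have hcd : ⁅T x, S y⁆ = ⁅S x, T y⁆ := by
    have h1 := hST1 x y
    have h2 := hST1 y x
    rw [← lie_skew (S y) (S x), ← lie_skew (S y) (T x), anticomm y x, map_neg, h1] at h2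
    apply smul_right_injective L hchar2
    beta_reduce
    linear_combination (norm := module) -h2
  have hS := hST1 x y
  have hT := hST2 x y
  rw [anticomm y x, map_neg, hcd] at hT
  have hPP : ⁅P x, P y⁆ = S (mul x y) - T (mul x y) - (2 : F) • ⁅S x, T y⁆ := by
    simp only [hP, LinearMap.neg_apply, LinearMap.add_apply, neg_lie, lie_neg,
      add_lie, lie_add, hcd, hS, hT]
    module
  rw [hY, smul_inv_smul₀ h6, hPP, hS, hT, hSp, hTp, hPp, hP]
  simp only [LinearMap.neg_apply, LinearMap.add_apply, LinearMap.sub_apply]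
  refine ⟨?_, ?_, ?_⟩ <;> module
end

section
/- Let (S,T) be a Moufang-Mal'tsev pair, set P := -(S+T), define the triality conjugates S⁺ := T - P, T⁺ := P - S, P⁺ := S - T, and define the Yamagutian Y : M × M → L by Y(x;y) := (1/6)([S_x,S_y] + [T_x,T_y] + [P_x,P_y]). Then 6Y(x;y) = 2P⁺_{[x,y]} - 6[S_x,T_y] = 2S⁺_{[x,y]} - 6[T_x,P_y] = 2T⁺_{[x,y]} - 6[P_x,S_y] for all x, y in M. -/
/-- Moufang-Mal'tsev pair: context shared by all statements.
`F` is a field of characteristic ≠ 2, 3; `M` an `F`-vector space with an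
anticommutative bilinear multiplication `mul`; `L` a Lie algebra over `F`;
`S, T : M →ₗ[F] L` satisfy the Moufang-Mal'tsev relations. -/
theorem stmt_9
    (F : Type*) [Field F] (hchar2 : (2 : F) ≠ 0) (hchar3 : (3 : F) ≠ 0)
    (M : Type*) [AddCommGroup M] [Module F M]
    (L : Type*) [LieRing L] [LieAlgebra F L]
    (mul : M →ₗ[F] M →ₗ[F] M)
    (anticomm : ∀ x y : M, mul x y = - mul y x)
    (S T : M →ₗ[F] L)
    (hST1 : ∀ x y : M, ⁅S x, S y⁆ = S (mul x y) - (2 : F) • ⁅S x, T y⁆)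
    (hST2 : ∀ x y : M, ⁅T x, T y⁆ = T (mul y x) - (2 : F) • ⁅T x, S y⁆)
    (P : M →ₗ[F] L) (hP : P = -(S + T))
    (Sp : M →ₗ[F] L) (hSp : Sp = T - P)
    (Tp : M →ₗ[F] L) (hTp : Tp = P - S)
    (Pp : M →ₗ[F] L) (hPp : Pp = S - T)
    (Y : M → M → L)
    (hY : ∀ x y : M, Y x y = (6 : F)⁻¹ • (⁅S x, S y⁆ + ⁅T x, T y⁆ + ⁅P x, P y⁆))
    :
    ∀ x y : M,
      (6 : F) • Y x y = (2 : F) • Pp (mul x y) - (6 : F) • ⁅S x, T y⁆ ∧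
      (6 : F) • Y x y = (2 : F) • Sp (mul x y) - (6 : F) • ⁅T x, P y⁆ ∧
      (6 : F) • Y x y = (2 : F) • Tp (mul x y) - (6 : F) • ⁅P x, S y⁆ := by
  intro x y
  have h6 : (6 : F) ≠ 0 := by
    have h : (6 : F) = 2 * 3 := by norm_num
    exact h ▸ mul_ne_zero hchar2 hchar3
  -- `⁅S x, T y⁆` is antisymmetric in `x, y` because `⁅S x, S y⁆` and `mul x y` are.
  have hTS : ⁅T x, S y⁆ = ⁅S x, T y⁆ := by
    have hxy := hST1 x y
    have hyx := hST1 y x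
    rw [← lie_skew, anticomm y x, map_neg, ← lie_skew (S y) (T x)] at hyx
    refine smul_right_injective L hchar2 ?_
    linear_combination (norm := module) (-1 : F) • (hxy + hyx)
  have hSS := hST1 x y
  have hTT := hST2 x y
  rw [anticomm y x, map_neg, hTS] at hTT
  subst hP hSp hTp hPp
  rw [hY, smul_inv_smul₀ h6]
  simp only [LinearMap.neg_apply, LinearMap.add_apply, LinearMap.sub_apply, neg_lie, lie_neg,
    add_lie, lie_add, hSS, hTT, hTS]
  refine ⟨?_, ?_, ?_⟩ <;> module
end
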